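/- Let 𝒱 be a finite set, f a non-increasing set function on 𝒱, γ ∈ (0,1] a supermodularity-ratio lower bound for f, and c a cost function on 𝒱. Let S* be a nonempty subset of 𝒱 with total cost b* = c(S*), and let s₁, …, s_m be a greedy sequence for (f, c) with G_i = {s₁,…,s_i}. Assume γ·c(s_j) ≤ b* for every j ∈ {1,…,m}. Then for every i ∈ {1, …, m}: f(∅) − f(G_i) ≥ [1 − ∏_{j=1}^{i} (1 − γ·c(s_j)/b*)]·(f(∅) − f(S*)). -/

import Mathlib

open Finset Real

/-- adaptation of Krause–Guestrin Lemma 3: accumulated-gain bound for the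
greedy sequence. Zero-indexed: `G i = (range i).image s`, so the `i`-th greedy step adds
`s (i-1)`; for `1 ≤ i ≤ m`,
`f(∅) − f(G i) ≥ [1 − ∏_{j<i} (1 − γ·c(s j)/b*)]·(f(∅) − f(Sstar))`. -/
theorem stmt_3 {α : Type*} [Fintype α] [DecidableEq α]
    (f : Finset α → ℝ)
    (hmono : ∀ A B : Finset α, A ⊆ B → f B ≤ f A)
    (γ : ℝ) (hγ0 : 0 < γ) (hγ1 : γ ≤ 1)
    (hratio : ∀ A B : Finset α, A ⊆ B → ∀ v ∉ B,
      f A - f (insert v A) ≥ γ * (f B - f (insert v B)))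
    (c : α → ℝ) (hc : ∀ v, 0 < c v)
    (Sstar : Finset α) (hSstar : Sstar.Nonempty)
    (m : ℕ) (s : ℕ → α)
    (hdist : ∀ i < m, s i ∉ (Finset.range i).image s)
    (hgreedy : ∀ i < m, ∀ a ∉ (Finset.range i).image s,
      (f ((Finset.range i).image s) - f (insert a ((Finset.range i).image s))) / c a ≤
        (f ((Finset.range i).image s) -
            f (insert (s i) ((Finset.range i).image s))) / c (s i))
    -- each single greedy-step cost satisfies `γ·c(s_j) ≤ b*`
    (hcost : ∀ j < m, γ * c (s j) ≤ ∑ v ∈ Sstar, c v) :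
    ∀ i, 1 ≤ i → i ≤ m →
      f ∅ - f ((Finset.range i).image s) ≥
        (1 - ∏ j ∈ Finset.range i, (1 - γ * c (s j) / (∑ v ∈ Sstar, c v))) *
          (f ∅ - f Sstar) := by
  have hb : 0 < ∑ v ∈ Sstar, c v := Finset.sum_pos (fun v _ => hc v) hSstar
  have key : ∀ i, i ≤ m → f ((Finset.range i).image s) - f Sstar ≤
      (∏ j ∈ Finset.range i, (1 - γ * c (s j) / (∑ v ∈ Sstar, c v))) * (f ∅ - f Sstar) := by
    intro i
    induction i with
    | zero => intro _; simp
    | succ i ih =>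
      intro hi
      have him : i < m := by omega
      have ih' := ih him.le
      have hg := hgreedy i him
      have hco := hcost i him
      rw [Finset.prod_range_succ, Finset.range_add_one, Finset.image_insert]
      generalize (Finset.range i).image s = G at *
      have hcs := hc (s i)
      have hr : 0 ≤ (f G - f (insert (s i) G)) / c (s i) :=
        div_nonneg (sub_nonneg.2 (hmono _ _ (Finset.subset_insert _ _))) hcs.le
      have hrc : (f G - f (insert (s i) G)) = (f G - f (insert (s i) G)) / c (s i) * c (s i) := by
        field_simp
      generalize (f G - f (insert (s i) G)) / c (s i) = r at *
      have hT : ∀ T : Finset α, γ * (f G - f (G ∪ T)) ≤ r * ∑ v ∈ T, c v := by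
        intro T
        induction T using Finset.induction_on with
        | empty => simp
        | insert v T hv ihT =>
          rw [Finset.sum_insert hv, Finset.union_insert]
          have hcv := hc v
          by_cases hvG : v ∈ G ∪ T
          · rw [Finset.insert_eq_of_mem hvG]
            nlinarith [mul_nonneg hr hcv.le]
          · have h1 := hratio G (G ∪ T) Finset.subset_union_left v hvG
            have h2 := hg v (fun h => hvG (Finset.mem_union_left _ h))
            rw [div_le_iff₀ hcv] at h2
            nlinarith
      have h3 := hT Sstar
      have h4 := hmono Sstar (G ∪ Sstar) Finset.subset_union_right
      generalize (∑ v ∈ Sstar, c v) = b at *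
      have h5 : γ * (f G - f Sstar) ≤ r * b := by nlinarith
      have hp : 0 ≤ 1 - γ * c (s i) / b := by
        rw [sub_nonneg, div_le_one hb]; exact hco
      have h6 : γ * c (s i) / b * (f G - f Sstar) ≤ r * c (s i) := by
        rw [div_mul_eq_mul_div, div_le_iff₀ hb]
        nlinarith [mul_le_mul_of_nonneg_right h5 hcs.le]
      have h7 := mul_le_mul_of_nonneg_right ih' hp
      linarith
  intro i _ hi
  have := key i hi
  linarith
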